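/- Let c ∈ de(b) with c ≠ b and let W = an(c). If b is fixable in G_W (de_W(b) ∩ dis_W(b) = {b}), then for every D-supported Λ and B-compatible Ω, P b c = β_{bc·S}, where S = mb_W(b). -/

import Mathlib

open Matrix

attribute [local instance] Classical.propDecidable

namespace EdgeIntervention

variable {n : ℕ}

/-- Descendants of `b` (including `b`): vertices reachable under the edge relation of `D`. -/
def desc (D : Set (Fin n × Fin n)) (b : Fin n) : Set (Fin n) :=
  {c | Relation.ReflTransGen (fun i j => (i, j) ∈ D) b c}

/-- Ancestors of `c` (including `c`). -/
def anc (D : Set (Fin n × Fin n)) (c : Fin n) : Set (Fin n) :=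
  {i | c ∈ desc D i}

/-- Descendants of `b` in the induced subgraph on `W`. -/
def descW (D : Set (Fin n × Fin n)) (W : Set (Fin n)) (b : Fin n) : Set (Fin n) :=
  {c | Relation.ReflTransGen (fun i j => (i, j) ∈ D ∧ i ∈ W ∧ j ∈ W) b c}

/-- District of `b` in the induced subgraph on `W`. -/
def disW (B : Set (Fin n × Fin n)) (W : Set (Fin n)) (b : Fin n) : Set (Fin n) :=
  {c | Relation.ReflTransGen (fun i j => (i, j) ∈ B ∧ i ∈ W ∧ j ∈ W) b c}

/-- Markov blanket of `b` in the induced subgraph on `W`. -/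
def mbW (D B : Set (Fin n × Fin n)) (W : Set (Fin n)) (b : Fin n) : Set (Fin n) :=
  (disW B W b ∪ {i | i ∈ W ∧ ∃ d ∈ disW B W b, (i, d) ∈ D}) \ {b}

/-- `Λ` is supported on the directed edge set `D`. -/
def DSupported (D : Set (Fin n × Fin n)) (Λ : Matrix (Fin n) (Fin n) ℝ) : Prop :=
  ∀ i j, (i, j) ∉ D → Λ i j = 0

/-- `Ω` is compatible with the bidirected edge set `B`: symmetric, positive definite,
and vanishing off the diagonal and off `B`. -/
def BCompatible (B : Set (Fin n × Fin n)) (Ω : Matrix (Fin n) (Fin n) ℝ) : Prop :=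
  Ω.IsSymm ∧ Ω.PosDef ∧ ∀ i j, i ≠ j → (i, j) ∉ B → Ω i j = 0

/-- The covariance matrix `Σ = ((1 - Λ)⁻¹)ᵀ * Ω * (1 - Λ)⁻¹` of the linear SEM. -/
noncomputable def cov (Λ Ω : Matrix (Fin n) (Fin n) ℝ) : Matrix (Fin n) (Fin n) ℝ :=
  ((1 - Λ)⁻¹)ᵀ * Ω * (1 - Λ)⁻¹

/-- Sum over all directed paths from `i` to `j` of their weights.  A path with `k` edges is
encoded as `f : Fin (k+1) → Fin n` with all steps in `D`; since edges strictly increase,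
every directed path has at most `n` edges, so `k` ranges over `Finset.range (n+1)`. -/
noncomputable def pathSum (D : Set (Fin n × Fin n)) (Λ : Matrix (Fin n) (Fin n) ℝ)
    (i j : Fin n) : ℝ :=
  ∑ k ∈ Finset.range (n + 1),
    ∑ f ∈ Finset.univ.filter
        (fun f : Fin (k + 1) → Fin n =>
          f 0 = i ∧ f (Fin.last k) = j ∧ ∀ t : Fin k, (f t.castSucc, f t.succ) ∈ D),
      ∏ t : Fin k, Λ (f t.castSucc) (f t.succ)

/-- Conditional covariance `σ_{vw·S} = Σ v w − Σ_{vS} (Σ_{SS})⁻¹ Σ_{Sw}`. -/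
noncomputable def condCov (Cov : Matrix (Fin n) (Fin n) ℝ) (S : Set (Fin n))
    (v w : Fin n) : ℝ :=
  letI := (Set.toFinite S).fintype
  Cov v w - ∑ i : S, ∑ j : S,
    Cov v i.val * (Cov.submatrix (Subtype.val : S → Fin n) Subtype.val)⁻¹ i j * Cov j.val w

/-- Regression coefficient `β_{vw·S} = σ_{vw·S} / σ_{vv·S}`. -/
noncomputable def regCoef (Cov : Matrix (Fin n) (Fin n) ℝ) (S : Set (Fin n))
    (v w : Fin n) : ℝ :=
  condCov Cov S v w / condCov Cov S v v

/-- The matrix obtained from `Λ` by setting the `(a,b)` entry to `0`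
(removal of the directed edge `a → b`). -/
def removeEdge (Λ : Matrix (Fin n) (Fin n) ℝ) (a b : Fin n) : Matrix (Fin n) (Fin n) ℝ :=
  Matrix.of fun i j => if i = a ∧ j = b then 0 else Λ i j

/-- The matrix obtained from `Ω` by setting the `(a,b)` and `(b,a)` entries to `0`
(removal of the bidirected edge `a ↔ b`). -/
def removeBi (Ω : Matrix (Fin n) (Fin n) ℝ) (a b : Fin n) : Matrix (Fin n) (Fin n) ℝ :=
  Matrix.of fun i j => if (i = a ∧ j = b) ∨ (i = b ∧ j = a) then 0 else Ω i j

theorem isUnit_det_one_sub {D : Set (Fin n × Fin n)} (hD : ∀ i j : Fin n, (i, j) ∈ D → i < j)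
    {Λ : Matrix (Fin n) (Fin n) ℝ} (hΛ : DSupported D Λ) : IsUnit (1 - Λ).det := by
  have hzero : ∀ i j : Fin n, j ≤ i → Λ i j = 0 := fun i j hji =>
    hΛ i j fun h => absurd (hD i j h) (not_lt.mpr hji)
  have htri : (1 - Λ).IsUpperTriangular := by
    intro i j hij
    have hij' : j < i := hij
    simp [hzero i j hij'.le, one_apply_ne hij'.ne']
  rw [det_of_isUpperTriangular htri]
  simp [hzero _ _ le_rfl]

theorem inv_one_sub_apply {Λ : Matrix (Fin n) (Fin n) ℝ} (hU : IsUnit (1 - Λ).det)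
    (i s : Fin n) :
    (1 - Λ)⁻¹ i s = (if i = s then 1 else 0) + ∑ j, (1 - Λ)⁻¹ i j * Λ j s := by
  have h := congrFun (congrFun (nonsing_inv_mul _ hU) i) s
  rw [Matrix.mul_sub, Matrix.mul_one, Matrix.sub_apply, mul_apply, one_apply] at h
  linarith

theorem mem_desc_of_inv_one_sub_ne_zero {D : Set (Fin n × Fin n)}
    (hD : ∀ i j : Fin n, (i, j) ∈ D → i < j) {Λ : Matrix (Fin n) (Fin n) ℝ}
    (hΛ : DSupported D Λ) (i s : Fin n) : (1 - Λ)⁻¹ i s ≠ 0 → s ∈ desc D i := by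
  induction s using WellFoundedLT.induction with
  | ind s ih =>
    intro hs
    by_cases his : i = s
    · exact his ▸ Relation.ReflTransGen.refl
    rw [inv_one_sub_apply (isUnit_det_one_sub hD hΛ), if_neg his, zero_add] at hs
    obtain ⟨j, -, hj⟩ := Finset.exists_ne_zero_of_sum_ne_zero hs
    have hjs : (j, s) ∈ D := by
      by_contra h
      exact right_ne_zero_of_mul hj (hΛ j s h)
    exact Relation.ReflTransGen.tail (ih j (hD j s hjs) (left_ne_zero_of_mul hj)) hjs

theorem le_of_mem_desc {D : Set (Fin n × Fin n)} (hD : ∀ i j : Fin n, (i, j) ∈ D → i < j)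
    {i j : Fin n} (h : j ∈ desc D i) : i ≤ j := by
  induction h with
  | refl => exact le_rfl
  | tail _ hjk ih => exact ih.trans (hD _ _ hjk).le

theorem inv_one_sub_diag {D : Set (Fin n × Fin n)} (hD : ∀ i j : Fin n, (i, j) ∈ D → i < j)
    {Λ : Matrix (Fin n) (Fin n) ℝ} (hΛ : DSupported D Λ) (i : Fin n) :
    (1 - Λ)⁻¹ i i = 1 := by
  rw [inv_one_sub_apply (isUnit_det_one_sub hD hΛ), if_pos rfl, Finset.sum_eq_zero, add_zero]
  intro j _
  by_contra h
  have hji : (j, i) ∈ D := by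
    by_contra hn
    exact right_ne_zero_of_mul h (hΛ j i hn)
  exact absurd (hD j i hji) (not_lt.mpr (le_of_mem_desc hD
    (mem_desc_of_inv_one_sub_ne_zero hD hΛ i j (left_ne_zero_of_mul h))))

theorem mem_descW_anc {D : Set (Fin n × Fin n)} {c b s : Fin n} (hs : s ∈ anc D c)
    (h : s ∈ desc D b) : s ∈ descW D (anc D c) b := by
  induction h with
  | refl => exact Relation.ReflTransGen.refl
  | @tail j k _ hjk ih =>
    have hj : j ∈ anc D c := Relation.ReflTransGen.head hjk hs
    exact Relation.ReflTransGen.tail (ih hj) ⟨hjk, hj, hs⟩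

theorem disW_subset {B : Set (Fin n × Fin n)} {W : Set (Fin n)} {b : Fin n} (hb : b ∈ W) :
    disW B W b ⊆ W := by
  intro e he
  cases he with
  | refl => exact hb
  | tail _ h => exact h.2.2

theorem posDef_cov {Λ Ω : Matrix (Fin n) (Fin n) ℝ} (hU : IsUnit (1 - Λ).det)
    (hΩ : Ω.PosDef) : (cov Λ Ω).PosDef := by
  have hP : IsUnit (1 - Λ)⁻¹ := (isUnit_nonsing_inv_iff).mpr ((isUnit_iff_isUnit_det _).mpr hU)
  simpa [cov, conjTranspose_eq_transpose_of_trivial] using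
    hΩ.conjTranspose_mul_mul_same (mulVec_injective_of_isUnit hP)

/-- A row of the inverse of the principal submatrix of `Ω` on `E`, extended by zero. -/
theorem exists_vecMul_eq_single {Ω : Matrix (Fin n) (Fin n) ℝ} (hΩ : Ω.PosDef)
    {E : Set (Fin n)} {b : Fin n} (hb : b ∈ E) :
    ∃ v : Fin n → ℝ, (∀ i ∉ E, v i = 0) ∧ 0 < v b ∧
      ∀ e ∈ E, (v ᵥ* Ω) e = if b = e then 1 else 0 := by
  set A : Matrix E E ℝ := Ω.submatrix Subtype.val Subtype.val with hA
  have hpos : A.PosDef := hΩ.submatrix Subtype.val_injective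
  refine ⟨fun i => if h : i ∈ E then A⁻¹ ⟨b, hb⟩ ⟨i, h⟩ else 0, fun i hi => dif_neg hi, ?_, ?_⟩
  · simpa [hb] using hpos.inv.diag_pos (i := ⟨b, hb⟩)
  · intro e he
    have h := congrFun (congrFun (nonsing_inv_mul A
      ((isUnit_iff_isUnit_det _).mp hpos.isUnit)) ⟨b, hb⟩) ⟨e, he⟩
    rw [mul_apply, one_apply] at h
    simp only [Subtype.mk.injEq] at h
    rw [← h, vecMul, dotProduct, ← Finset.sum_subset (Finset.subset_univ E.toFinset)
      (by intro i _ hi; rw [dif_neg (by simpa using hi), zero_mul]),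
      Finset.sum_subtype E.toFinset (p := (· ∈ E)) (by simp)]
    exact Finset.sum_congr rfl fun i _ => by rw [dif_pos i.2]; rfl

/-- The conditional covariance read off from a linear combination of `b` and `S` that is
uncorrelated with `S`. -/
theorem mul_condCov_eq_vecMul {C : Matrix (Fin n) (Fin n) ℝ} (hC : C.PosDef)
    {S : Set (Fin n)} {b : Fin n} (hb : b ∉ S) {u : Fin n → ℝ}
    (hu : ∀ i, i ∉ S → i ≠ b → u i = 0) (horth : ∀ s ∈ S, (u ᵥ* C) s = 0) (w : Fin n) :
    u b * condCov C S b w = (u ᵥ* C) w := by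
  unfold condCov
  let := (Set.toFinite S).fintype
  have hsum : ∀ x, (u ᵥ* C) x = u b * C b x + ∑ i : S, u i.val * C i.val x := by
    intro x
    rw [vecMul, dotProduct, ← Finset.sum_subset
      (Finset.subset_univ (insert b S.toFinset)), Finset.sum_insert (by simpa using hb),
      Finset.sum_subtype S.toFinset (p := (· ∈ S)) (by simp)]
    intro i _ hi
    simp only [Finset.mem_insert, Set.mem_toFinset, not_or] at hi
    rw [hu i hi.2 hi.1, zero_mul]
  set A : Matrix S S ℝ := C.submatrix Subtype.val Subtype.val with hA
  have hunit : IsUnit A.det := (isUnit_iff_isUnit_det _).mp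
    (hC.submatrix Subtype.val_injective).isUnit
  have hrow : (fun i : S => u i.val) ᵥ* A = fun s : S => -(u b * C b s.val) := by
    funext s
    have h := horth s.val s.2
    rw [hsum] at h
    exact eq_neg_of_add_eq_zero_right h
  have hsol : ∀ j : S, u j.val = -(u b * ∑ i : S, C b i.val * A⁻¹ i j) := by
    intro j
    have h := congrFun (congrArg (· ᵥ* A⁻¹) hrow) j
    simp only [vecMul_vecMul, mul_nonsing_inv _ hunit, vecMul_one] at h
    rw [h, vecMul, dotProduct, Finset.mul_sum, ← Finset.sum_neg_distrib]
    exact Finset.sum_congr rfl fun i _ => by ring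
  rw [hsum, Finset.sum_comm, mul_sub, sub_eq_add_neg, Finset.mul_sum, ← Finset.sum_neg_distrib]
  congr 1
  refine Finset.sum_congr rfl fun j _ => ?_
  rw [hsol j, ← Finset.sum_mul]
  ring

/-- if `b` is fixable in `G_W` for `W = an(c)`, then the directed-path sum
`P b c` equals the regression coefficient `β_{bc·S}` with `S = mb_W(b)`. -/
theorem pathSum_regression_identifiable (n : ℕ) (D B : Set (Fin n × Fin n))
    (hD : ∀ i j : Fin n, (i, j) ∈ D → i < j)
    (hBsymm : ∀ i j : Fin n, (i, j) ∈ B → (j, i) ∈ B)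
    (hBirr : ∀ i : Fin n, (i, i) ∉ B)
    (b c : Fin n) (hc : c ∈ desc D b) (hcb : c ≠ b)
    (hfix : descW D (anc D c) b ∩ disW B (anc D c) b = {b}) :
    ∀ Λ Ω : Matrix (Fin n) (Fin n) ℝ, DSupported D Λ → BCompatible B Ω →
      (1 - Λ)⁻¹ b c = regCoef (cov Λ Ω) (mbW D B (anc D c) b) b c := by
  intro Λ Ω hΛ ⟨_, hΩ, hΩB⟩
  set W := anc D c with hW
  set E := disW B W b with hE
  set P := (1 - Λ)⁻¹ with hP
  have hU := isUnit_det_one_sub hD hΛ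
  have hbW : b ∈ W := hc
  have hbE : b ∈ E := Relation.ReflTransGen.refl
  have hEW : E ⊆ W := disW_subset hbW
  have hfix' : ∀ e ∈ E, e ∈ desc D b → e = b := fun e he hd =>
    hfix.subset ⟨mem_descW_anc (hEW he) hd, he⟩
  obtain ⟨v, hvE, hvb, hvΩ⟩ := exists_vecMul_eq_single hΩ hbE
  have hvW : ∀ w ∈ W, (v ᵥ* Ω) w = if b = w then 1 else 0 := by
    intro w hw
    by_cases hwE : w ∈ E
    · exact hvΩ w hwE
    rw [if_neg fun h : b = w => hwE (h ▸ hbE), vecMul, dotProduct]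
    refine Finset.sum_eq_zero fun e _ => ?_
    by_cases he : e ∈ E
    · rw [hΩB e w (fun h : e = w => hwE (h ▸ he)) fun hew =>
        hwE (Relation.ReflTransGen.tail he ⟨hew, hEW he, hw⟩), mul_zero]
    · rw [hvE e he, zero_mul]
  set u : Fin n → ℝ := fun i => v i - ∑ d, Λ i d * v d with hu
  have hu_vecMul : u = v ᵥ* (1 - Λ)ᵀ := by
    rw [vecMul_transpose, sub_mulVec, one_mulVec]
    rfl
  have hcov : u ᵥ* cov Λ Ω = (v ᵥ* Ω) ᵥ* P := by
    rw [hu_vecMul, vecMul_vecMul, vecMul_vecMul, cov, ← Matrix.mul_assoc, ← Matrix.mul_assoc,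
      ← transpose_mul, nonsing_inv_mul _ hU, transpose_one, Matrix.one_mul]
  have hcovW : ∀ w ∈ W, (u ᵥ* cov Λ Ω) w = P b w := by
    intro w hw
    rw [hcov, vecMul, dotProduct, Finset.sum_eq_single b, hvW b hbW, if_pos rfl, one_mul]
    · intro i _ hib
      by_cases hiw : P i w = 0
      · rw [hiw, mul_zero]
      · have hiW : i ∈ W := (mem_desc_of_inv_one_sub_ne_zero hD hΛ i w hiw).trans hw
        rw [hvW i hiW, if_neg hib.symm, zero_mul]
    · exact fun h => absurd (Finset.mem_univ b) h
  have hub : u b = v b := by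
    rw [hu]
    refine sub_eq_self.mpr (Finset.sum_eq_zero fun d _ => ?_)
    by_cases hd : d ∈ E
    · rw [hΛ b d fun hbd => (hD b d hbd).ne' (hfix' d hd (.single hbd)), zero_mul]
    · rw [hvE d hd, mul_zero]
  have husupp : ∀ i, i ∉ mbW D B W b → i ≠ b → u i = 0 := by
    intro i hi hib
    have hiE : i ∉ E := fun h => hi ⟨Or.inl h, hib⟩
    rw [hu]
    simp only [hvE i hiE, zero_sub, neg_eq_zero]
    refine Finset.sum_eq_zero fun d _ => ?_
    by_cases hd : d ∈ E
    · rw [hΛ i d fun hid => hi ⟨Or.inr ⟨Relation.ReflTransGen.head hid (hEW hd), d, hd, hid⟩,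
        hib⟩, zero_mul]
    · rw [hvE d hd, mul_zero]
  have horth : ∀ s ∈ mbW D B W b, (u ᵥ* cov Λ Ω) s = 0 := by
    rintro s ⟨hs, hsb⟩
    have hsW : s ∈ W := hs.elim (fun h => hEW h) fun h => h.1
    rw [hcovW s hsW]
    by_contra hne
    have hdesc := mem_desc_of_inv_one_sub_ne_zero hD hΛ b s hne
    rcases hs with hs | ⟨-, d, hd, hsd⟩
    · exact hsb (hfix' s hs hdesc)
    · have hdb := hfix' d hd (Relation.ReflTransGen.tail hdesc hsd)
      exact absurd (hdb ▸ hD s d hsd) (not_lt.mpr (le_of_mem_desc hD hdesc))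
  have hcond := mul_condCov_eq_vecMul (posDef_cov hU hΩ)
    (fun h : b ∈ mbW D B W b => h.2 rfl) husupp horth
  have hc' := hcond c
  have hb' := hcond b
  rw [hcovW c Relation.ReflTransGen.refl] at hc'
  rw [hcovW b hbW, hP, inv_one_sub_diag hD hΛ] at hb'
  have hub0 : u b ≠ 0 := hub ▸ hvb.ne'
  rw [regCoef, ← mul_div_mul_left _ _ hub0, hc', hb', div_one]

end EdgeIntervention
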